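/- Let φ : ℝ → ℝ be a nonconstant solution of φ″ = W′(φ) homoclinic to b₋, with W smooth and α₋ := W″(b₋) > 0. Then the linearized operator L₀ = d²/dz² − W″(φ) on L²(ℝ) has 0 as an eigenvalue with eigenfunction φ′, and since φ′ changes sign (φ′ vanishes at exactly one point), 0 is not the ground-state eigenvalue; consequently L₀ has a positive simple ground-state eigenvalue λ₀ > 0 with a positive eigenfunction ψ₀. -/

import Mathlib

open Filter Topology MeasureTheory Set

/-- `f` solves the equation (second derivative of f) = q f with first derivative `g`. -/
def IsSol7 (q f g : ℝ → ℝ) : Prop :=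
  ∀ z, HasDerivAt f (g z) z ∧ HasDerivAt g (q z * f z) z

theorem mono_of_deriv7 {E E' : ℝ → ℝ} (a : ℝ) (h : ∀ z, HasDerivAt E (E' z) z)
    (hn : ∀ z, a ≤ z → 0 ≤ E' z) {x y : ℝ} (hx : a ≤ x) (hxy : x ≤ y) : E x ≤ E y := by
  have : MonotoneOn E (Ici a) := by
    apply monotoneOn_of_deriv_nonneg (convex_Ici a)
    · exact fun z _ => (h z).continuousAt.continuousWithinAt
    · exact fun z _ => (h z).differentiableAt.differentiableWithinAt
    · intro z hz
      rw [(h z).deriv]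
      rw [interior_Ici] at hz
      exact hn z (le_of_lt hz)
  exact this hx (hx.trans hxy) hxy

theorem zero_right7 {f g h : ℝ → ℝ} {K a : ℝ} (hf : ∀ z, HasDerivAt f (g z) z)
    (hg : ∀ z, HasDerivAt g (h z) z) (hK : ∀ z, |h z| ≤ K * |f z|)
    (h0 : f a = 0) (h1 : g a = 0) (z : ℝ) (hz : a ≤ z) : f z = 0 ∧ g z = 0 := by
  have key : ∀ z, HasDerivAt (fun z => -((f z ^ 2 + g z ^ 2) * Real.exp (-(1 + K ^ 2 + 1) * z)))
      (-((2 * f z * g z + 2 * g z * h z) * Real.exp (-(1 + K ^ 2 + 1) * z) +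
        (f z ^ 2 + g z ^ 2) * (Real.exp (-(1 + K ^ 2 + 1) * z) * (-(1 + K ^ 2 + 1))))) z := by
    intro z
    have e := ((hasDerivAt_id z).const_mul (-(1 + K ^ 2 + 1))).exp
    refine ((((hf z).pow 2).add ((hg z).pow 2)).mul e).neg.congr_deriv ?_
    simp
  have := mono_of_deriv7 a key (fun z _ => by
    have hh : h z ^ 2 ≤ K ^ 2 * f z ^ 2 := by
      rw [← sq_abs, ← sq_abs (f z), ← mul_pow]
      exact pow_le_pow_left₀ (abs_nonneg _) (hK z) 2
    have : 2 * f z * g z + 2 * g z * h z ≤ (1 + K ^ 2 + 1) * (f z ^ 2 + g z ^ 2) := by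
      nlinarith [sq_nonneg (f z - g z), sq_nonneg (g z - h z), mul_nonneg (sq_nonneg K) (sq_nonneg (g z))]
    have e := Real.exp_pos (-(1 + K ^ 2 + 1) * z)
    nlinarith) le_rfl hz
  simp only [h0, h1] at this
  have e := Real.exp_pos (-(1 + K ^ 2 + 1) * z)
  have hle : f z ^ 2 + g z ^ 2 ≤ 0 := by
    by_contra hc
    push Not at hc
    nlinarith [mul_pos hc e]
  constructor <;> nlinarith [sq_nonneg (f z), sq_nonneg (g z)]

theorem comp_neg7 {f : ℝ → ℝ} {d z : ℝ} (h : HasDerivAt f d (-z)) :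
    HasDerivAt (fun x => f (-x)) (-d) z := by
  have := h.comp z (hasDerivAt_neg z)
  simpa [Function.comp_def] using this

theorem zero7 {f g h : ℝ → ℝ} {K a : ℝ} (hf : ∀ z, HasDerivAt f (g z) z)
    (hg : ∀ z, HasDerivAt g (h z) z) (hK : ∀ z, |h z| ≤ K * |f z|)
    (h0 : f a = 0) (h1 : g a = 0) (z : ℝ) : f z = 0 ∧ g z = 0 := by
  rcases le_total a z with hz | hz
  · exact zero_right7 hf hg hK h0 h1 z hz
  · have := zero_right7 (f := fun x => f (-x)) (g := fun x => -g (-x)) (h := fun x => h (-x))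
      (K := K) (a := -a) (fun x => comp_neg7 (hf (-x)))
      (fun x => (comp_neg7 (hg (-x))).neg.congr_deriv (by simp)) (fun x => hK (-x)) (by simpa using h0)
      (by simpa using h1) (-z) (by linarith)
    simpa using this

theorem IsSol7.zero {q f g : ℝ → ℝ} {K a : ℝ} (h : IsSol7 q f g) (hK : ∀ z, |q z| ≤ K)
    (h0 : f a = 0) (h1 : g a = 0) (z : ℝ) : f z = 0 ∧ g z = 0 :=
  zero7 (fun z => (h z).1) (fun z => (h z).2) (K := K) (fun z => by
    rw [abs_mul]; exact mul_le_mul_of_nonneg_right (hK z) (abs_nonneg _)) h0 h1 z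

theorem IsSol7.grow {q f g : ℝ → ℝ} {a : ℝ} (h : IsSol7 q f g) (hq : ∀ z, a ≤ z → 0 ≤ q z)
    (h0 : 0 < f a) (h1 : 0 ≤ g a) (z : ℝ) (hz : a ≤ z) : 0 < f z := by
  have k1 : ∀ z, a ≤ z → 0 ≤ f z * g z := by
    intro z hz
    have := mono_of_deriv7 a (fun z => (h z).1.mul (h z).2) (fun z hz => by
      nlinarith [mul_nonneg (hq z hz) (sq_nonneg (f z)), sq_nonneg (g z)]) le_rfl hz
    simp only [Pi.mul_apply] at this
    nlinarith [mul_nonneg h0.le h1]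
  have k2 : ∀ z, a ≤ z → f z ≠ 0 := by
    intro z hz hfz
    have := mono_of_deriv7 a (fun z => (h z).1.mul (h z).1) (fun z hz => by
      nlinarith [k1 z hz]) le_rfl hz
    simp only [Pi.mul_apply, hfz] at this
    nlinarith
  by_contra hc
  push Not at hc
  have hcont : Continuous f := continuous_iff_continuousAt.2 fun z => (h z).1.continuousAt
  obtain ⟨x, hx, hx0⟩ := intermediate_value_Icc' hz hcont.continuousOn ⟨hc, h0.le⟩
  exact k2 x hx.1 hx0

theorem ineq7 (d d' f q ε B M : ℝ) (hq2 : q ^ 2 ≤ M ^ 2) (hε2 : ε ^ 2 * f ^ 2 ≤ ε ^ 2 * B ^ 2) :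
    2 * d * d' + 2 * d' * (q * d + ε * f) ≤ (M ^ 2 + 2) * (d ^ 2 + d' ^ 2) + ε ^ 2 * B ^ 2 := by
  have a1 : 2 * d * d' ≤ d ^ 2 + d' ^ 2 := by nlinarith [sq_nonneg (d - d')]
  have a2 : 2 * d' * (ε * f) ≤ d' ^ 2 + ε ^ 2 * f ^ 2 := by
    nlinarith [sq_nonneg (d' - ε * f)]
  have a3 : 2 * d' * (q * d) ≤ M^2 * d' ^ 2 + d ^ 2 := by
    nlinarith [sq_nonneg (q * d' - d), mul_le_mul_of_nonneg_right hq2 (sq_nonneg d')]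
  nlinarith [mul_nonneg (sq_nonneg M) (sq_nonneg d), sq_nonneg d, sq_nonneg d']

theorem near7 {V f g : ℝ → ℝ} {K μ : ℝ} (hK : ∀ z, |V z| ≤ K)
    (h : IsSol7 (fun z => V z + μ) f g) (T δ : ℝ) (hδ : 0 < δ) :
    ∃ ε₀ > 0, ∀ ε, |ε| < ε₀ → ∀ f₂ g₂, IsSol7 (fun z => V z + (μ + ε)) f₂ g₂ → f₂ 0 = f 0 →
      g₂ 0 = g 0 → ∀ t, 0 ≤ t → t ≤ T → |f₂ t - f t| ≤ δ ∧ |g₂ t - g t| ≤ δ := by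
  have hcont : Continuous f := continuous_iff_continuousAt.2 fun z => (h z).1.continuousAt
  obtain ⟨B, hB⟩ := (isCompact_Icc (a := (0:ℝ)) (b := T)).exists_bound_of_continuousOn hcont.continuousOn
  set M := K + |μ| + 1 with hM
  set C := M ^ 2 + 2 with hC
  have hK0 : 0 ≤ K := (abs_nonneg _).trans (hK 0)
  -- choose the size of the perturbation
  have hlim : Tendsto (fun ε : ℝ => ε ^ 2 * (B ^ 2 * T * Real.exp (C * T))) (𝓝 0) (𝓝 0) := by
    have : Continuous (fun ε : ℝ => ε ^ 2 * (B ^ 2 * T * Real.exp (C * T))) := by fun_prop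
    simpa using this.tendsto 0
  obtain ⟨e, he, hlt⟩ := Metric.eventually_nhds_iff.1 (hlim.eventually (gt_mem_nhds (pow_pos hδ 2)))
  refine ⟨min e 1, lt_min he one_pos, ?_⟩
  intro ε hε f₂ g₂ h₂ i0 i1 t ht htT
  have hε1 : |ε| < 1 := hε.trans_le (min_le_right _ _)
  have hsmall := hlt (y := ε) (by simpa using hε.trans_le (min_le_left _ _))
  obtain ⟨d, hd⟩ : ∃ d : ℝ → ℝ, d = fun z => f₂ z - f z := ⟨_, rfl⟩
  obtain ⟨d', hd'⟩ : ∃ d : ℝ → ℝ, d = fun z => g₂ z - g z := ⟨_, rfl⟩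
  have D0 : ∀ z, HasDerivAt d (d' z) z := fun z => by
    rw [hd, hd']; exact (h₂ z).1.sub (h z).1
  have D1 : ∀ z, HasDerivAt d' ((V z + (μ + ε)) * d z + ε * f z) z := fun z => by
    rw [hd']
    refine ((h₂ z).2.sub (h z).2).congr_deriv ?_
    simp only [hd]; ring
  have key : ∀ z, HasDerivAt (fun z => (ε ^ 2 * B ^ 2) * z -
       ((d z ^ 2 + d' z ^ 2) * Real.exp (-C * z)))
      (ε ^ 2 * B ^ 2 - ((2 * d z * d' z + 2 * d' z * ((V z + (μ + ε)) * d z + ε * f z)) *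
        Real.exp (-C * z) +
        (d z ^ 2 + d' z ^ 2) * (Real.exp (-C * z) * (-C)))) z := by
    intro z
    have e := ((hasDerivAt_id z).const_mul (-C)).exp
    refine (((hasDerivAt_id z).const_mul (ε ^ 2 * B ^ 2)).sub
      ((((D0 z).pow 2).add ((D1 z).pow 2)).mul e)).congr_deriv ?_
    simp
  have hmono : MonotoneOn (fun z => (ε ^ 2 * B ^ 2) * z -
       ((d z ^ 2 + d' z ^ 2) * Real.exp (-C * z))) (Icc 0 T) := by
    apply monotoneOn_of_deriv_nonneg (convex_Icc 0 T)
    · exact fun z _ => (key z).continuousAt.continuousWithinAt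
    · exact fun z _ => (key z).differentiableAt.differentiableWithinAt
    · intro z hz
      rw [(key z).deriv]
      have hz' := interior_subset hz
      have hBz := hB z hz'
      rw [Real.norm_eq_abs] at hBz
      have hf2 : f z ^ 2 ≤ B ^ 2 := by
        rw [← sq_abs]; exact pow_le_pow_left₀ (abs_nonneg _) hBz 2
      have hq : |V z + (μ + ε)| ≤ M := by
        have := abs_add_three (V z) μ ε
        rw [← add_assoc]
        linarith [hK z]
      have hq2 : (V z + (μ + ε)) ^ 2 ≤ M ^ 2 := by
        rw [← sq_abs]; exact pow_le_pow_left₀ (abs_nonneg _) hq 2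
      generalize V z + (μ + ε) = q at *
      have hε2 : ε ^ 2 * f z ^ 2 ≤ ε ^ 2 * B ^ 2 := mul_le_mul_of_nonneg_left hf2 (sq_nonneg _)
      have e := Real.exp_pos (-C * z)
      have e1 : Real.exp (-C * z) ≤ 1 := by
        rw [Real.exp_le_one_iff]
        have : 0 ≤ C := by positivity
        nlinarith [hz'.1]
      have ineq := ineq7 (d z) (d' z) (f z) q ε B M hq2 hε2
      rw [← hC] at ineq
      have hp : 0 ≤ ε ^ 2 * B ^ 2 := by positivity
      have h1 := mul_le_mul_of_nonneg_right ineq e.le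
      have h2 := mul_le_mul_of_nonneg_left e1 hp
      linarith
  have hT : 0 ≤ T := ht.trans htT
  have := hmono ⟨le_rfl, hT⟩ ⟨ht, htT⟩ ht
  have z0 : d 0 = 0 := by simp [hd, i0]
  have z1 : d' 0 = 0 := by simp [hd', i1]
  simp only [z0, z1] at this
  have hb : (d t ^ 2 + d' t ^ 2) * Real.exp (-C * t) ≤ ε ^ 2 * B ^ 2 * t := by nlinarith
  have hb2 : d t ^ 2 + d' t ^ 2 ≤ ε ^ 2 * B ^ 2 * t * Real.exp (C * t) := by
    have e := Real.exp_pos (C * t)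
    have := mul_le_mul_of_nonneg_right hb e.le
    rwa [mul_assoc, ← Real.exp_add, show -C * t + C * t = 0 by ring, Real.exp_zero, mul_one] at this
  have hC0 : 0 ≤ C := by positivity
  have hb3 : ε ^ 2 * B ^ 2 * t * Real.exp (C * t) ≤ ε ^ 2 * B ^ 2 * T * Real.exp (C * T) := by
    gcongr
  have hfin : d t ^ 2 + d' t ^ 2 ≤ δ ^ 2 := by nlinarith
  have r1 : |d t| ≤ δ := abs_le_of_sq_le_sq (by nlinarith [sq_nonneg (d' t)]) hδ.le
  have r2 : |d' t| ≤ δ := abs_le_of_sq_le_sq (by nlinarith [sq_nonneg (d t)]) hδ.le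
  rw [hd] at r1
  rw [hd'] at r2
  exact ⟨r1, r2⟩

theorem kern_bound7 {p : ℝ → ℝ} {M C : ℝ} (hC : 0 < C)
    (hM : ∀ s, |p s| ≤ M * Real.cosh (C * s)) (t : ℝ) :
    |∫ s in (0:ℝ)..t, (t - s) * p s| ≤ M * Real.cosh (C * t) / C ^ 2 := by
  have hM0 : 0 ≤ M := by simpa using (abs_nonneg _).trans (hM 0)
  have hder : ∀ s, HasDerivAt (fun s => M * ((t - s) * Real.sinh (C * s) / C + Real.cosh (C * s) / C ^ 2))
      (M * ((t - s) * Real.cosh (C * s))) s := by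
    intro s
    have hl := (hasDerivAt_id s).const_mul C
    have h := ((((hasDerivAt_id s).const_sub t).mul hl.sinh).div_const C).add
      (hl.cosh.div_const (C^2))
    refine (h.const_mul M).congr_deriv ?_
    simp only [id]
    field_simp
    ring
  have hInteg : ∫ s in (0:ℝ)..t, M * ((t - s) * Real.cosh (C * s)) = M * (Real.cosh (C * t) - 1) / C ^ 2 := by
    rw [intervalIntegral.integral_eq_sub_of_hasDerivAt (fun s _ => hder s)
      (Continuous.intervalIntegrable (by fun_prop) _ _)]
    simp
    ring
  have hfin : M * (Real.cosh (C * t) - 1) / C ^ 2 ≤ M * Real.cosh (C * t) / C ^ 2 := by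
    gcongr; linarith
  rcases le_total 0 t with ht | ht
  · refine le_trans ?_ (hInteg.le.trans hfin)
    rw [← Real.norm_eq_abs]
    apply intervalIntegral.norm_integral_le_of_norm_le ht
    · refine Eventually.of_forall fun s hs => ?_
      rw [Real.norm_eq_abs, abs_mul, abs_of_nonneg (by linarith [hs.2])]
      nlinarith [hM s, hs.2]
    · exact Continuous.intervalIntegrable (by fun_prop) _ _
  · refine le_trans ?_ (hInteg.le.trans hfin)
    rw [intervalIntegral.integral_symm, abs_neg, intervalIntegral.integral_symm t 0,
      ← intervalIntegral.integral_neg, ← Real.norm_eq_abs]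
    apply intervalIntegral.norm_integral_le_of_norm_le ht
    · refine Eventually.of_forall fun s hs => ?_
      rw [Real.norm_eq_abs, abs_mul, abs_of_nonpos (by linarith [hs.1])]
      nlinarith [hM s, hs.1]
    · exact Continuous.intervalIntegrable (by fun_prop) _ _

theorem kern_deriv7 {p : ℝ → ℝ} (hp : Continuous p) (t : ℝ) :
    HasDerivAt (fun t => ∫ s in (0:ℝ)..t, (t - s) * p s) (∫ s in (0:ℝ)..t, p s) t := by
  have e : (fun t => ∫ s in (0:ℝ)..t, (t - s) * p s) =
      fun t => t * (∫ s in (0:ℝ)..t, p s) - ∫ s in (0:ℝ)..t, s * p s := by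
    funext t
    rw [← intervalIntegral.integral_const_mul, ← intervalIntegral.integral_sub]
    · simp only [sub_mul]
    · exact Continuous.intervalIntegrable (by fun_prop) _ _
    · exact Continuous.intervalIntegrable (by fun_prop) _ _
  rw [e]
  have h1 := (hp.integral_hasStrictDerivAt 0 t).hasDerivAt
  have h2 := ((by fun_prop : Continuous fun s => s * p s).integral_hasStrictDerivAt 0 t).hasDerivAt
  refine (((hasDerivAt_id t).mul h1).sub h2).congr_deriv ?_
  simp

open BoundedContinuousFunction in
theorem exists_sol7 {q : ℝ → ℝ} (hq : Continuous q) {Q : ℝ} (hQ : ∀ z, |q z| ≤ Q) :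
    ∃ f g, IsSol7 q f g ∧ f 0 = 1 ∧ g 0 = 0 := by
  have hQ0 : 0 ≤ Q := (abs_nonneg _).trans (hQ 0)
  set C := Q + 1 with hC
  have hC0 : 0 < C := by positivity
  have hCQ : Q / C ^ 2 ≤ 1 / 2 := by
    rw [div_le_div_iff₀ (by positivity) (by norm_num)]
    nlinarith
  have hpc : ∀ g : ℝ →ᵇ ℝ, Continuous (fun s => q s * (Real.cosh (C * s) * g s)) := by
    intro g
    have := g.continuous
    fun_prop
  let P : (ℝ →ᵇ ℝ) → ℝ → ℝ := fun g t =>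
    (1 + ∫ s in (0:ℝ)..t, (t - s) * (q s * (Real.cosh (C * s) * g s))) / Real.cosh (C * t)
  have hPc : ∀ g, Continuous (P g) := by
    intro g
    have : Continuous (fun t => ∫ s in (0:ℝ)..t, (t - s) * (q s * (Real.cosh (C * s) * g s))) :=
      continuous_iff_continuousAt.2 fun t => (kern_deriv7 (hpc g) t).continuousAt
    refine (continuous_const.add this).div (by fun_prop) fun t => (Real.cosh_pos _).ne'
  have hdiff : ∀ g h : ℝ →ᵇ ℝ, ∀ t, |P g t - P h t| ≤ (1/2) * dist g h := by
    intro g h t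
    have e : P g t - P h t =
        (∫ s in (0:ℝ)..t, (t - s) * (q s * (Real.cosh (C * s) * (g s - h s)))) / Real.cosh (C * t) := by
      simp only [P]
      rw [← sub_div, add_sub_add_left_eq_sub, ← intervalIntegral.integral_sub]
      · congr 2
        funext s
        ring
      · exact Continuous.intervalIntegrable ((by fun_prop : Continuous fun s => t - s).mul (hpc g)) _ _
      · exact Continuous.intervalIntegrable ((by fun_prop : Continuous fun s => t - s).mul (hpc h)) _ _
    rw [e, abs_div, abs_of_pos (Real.cosh_pos _), div_le_iff₀ (Real.cosh_pos _)]
    refine (kern_bound7 (M := Q * dist g h) hC0 ?_ t).trans ?_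
    · intro s
      rw [abs_mul, abs_mul, abs_of_pos (Real.cosh_pos _)]
      have h1 : |g s - h s| ≤ dist g h := by
        rw [← Real.dist_eq]; exact dist_coe_le_dist s
      have hc := Real.cosh_pos (C * s)
      calc |q s| * (Real.cosh (C * s) * |g s - h s|) ≤ Q * (Real.cosh (C * s) * dist g h) := by
            gcongr; exact hQ s
        _ = _ := by ring
    · have hc := Real.cosh_pos (C * t)
      calc Q * dist g h * Real.cosh (C * t) / C ^ 2 = (Q / C ^ 2) * dist g h * Real.cosh (C * t) := by ring
        _ ≤ _ := by gcongr
  have hP0 : ∀ t, |P 0 t| ≤ 1 := by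
    intro t
    simp only [P]
    simp [abs_of_pos (Real.cosh_pos _)]
    exact inv_le_one_of_one_le₀ (Real.one_le_cosh _)
  let F : (ℝ →ᵇ ℝ) → (ℝ →ᵇ ℝ) := fun g => ofNormedAddCommGroup (P g) (hPc g) (1 + (1/2) * dist g 0)
    (fun t => by
      rw [Real.norm_eq_abs]
      have h1 := hdiff g 0 t
      have h2 := hP0 t
      have h3 := abs_add_le (P g t - P 0 t) (P 0 t)
      rw [sub_add_cancel] at h3
      linarith)
  have hF : ContractingWith (1/2) F := by
    refine ⟨by rw [← NNReal.coe_lt_coe]; norm_num, LipschitzWith.of_dist_le_mul fun g h => ?_⟩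
    rw [dist_le (by positivity)]
    intro t
    rw [Real.dist_eq]
    have := hdiff g h t
    simpa [F] using this
  obtain ⟨g, hg⟩ : ∃ g, F g = g := ⟨_, hF.fixedPoint_isFixedPt⟩
  have hfix : ∀ t, Real.cosh (C * t) * g t =
      1 + ∫ s in (0:ℝ)..t, (t - s) * (q s * (Real.cosh (C * s) * g s)) := by
    intro t
    have : P g t = g t := by
      conv_rhs => rw [← hg]
      rfl
    rw [← this]
    simp only [P]
    field_simp [(Real.cosh_pos (C * t)).ne']
  refine ⟨fun t => Real.cosh (C * t) * g t, fun t => ∫ s in (0:ℝ)..t, q s * (Real.cosh (C * s) * g s),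
    fun z => ⟨?_, ?_⟩, ?_, ?_⟩
  · rw [show (fun t => Real.cosh (C * t) * g t) = _ from funext hfix]
    exact (kern_deriv7 (hpc g) z).const_add 1
  · exact ((hpc g).integral_hasStrictDerivAt 0 z).hasDerivAt
  · exact (hfix 0).trans (by simp)
  · simp

theorem nonint7 {f : ℝ → ℝ} (hf : Integrable f) {c a : ℝ} (hc : 0 < c)
    (h : ∀ z, a ≤ z → c ≤ f z) : False := by
  have h1 : IntegrableOn (fun _ : ℝ => c) (Ioi a) := by
    refine Integrable.mono' (hf.integrableOn (s := Ioi a)) (by fun_prop) ?_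
    refine (ae_restrict_iff' measurableSet_Ioi).2 (Eventually.of_forall fun z hz => ?_)
    rw [Real.norm_eq_abs, abs_of_pos hc]
    exact h z (le_of_lt hz)
  rw [integrableOn_const_iff] at h1
  rcases h1 with h1 | h1
  · exact hc.ne' (by simpa using h1)
  · simp at h1

/-- A function with derivative at most `-c < 0` on a half line is not bounded below. -/
theorem down7 {f g : ℝ → ℝ} (hf : ∀ z, HasDerivAt f (g z) z) {c a : ℝ} (hc : 0 < c)
    (h : ∀ z, a ≤ z → g z ≤ -c) (hpos : ∀ z, a ≤ z → 0 ≤ f z) : False := by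
  have key : ∀ z, HasDerivAt (fun z => -f z - c * z) (-g z - c) z := fun z =>
    ((hf z).neg.sub ((hasDerivAt_id z).const_mul c)).congr_deriv (by simp)
  have hfa := hpos a le_rfl
  have hz : a ≤ a + (f a + 1) / c := by
    have : 0 ≤ (f a + 1) / c := by positivity
    linarith
  have := mono_of_deriv7 a key (fun z hz => by linarith [h z hz]) le_rfl hz
  have h2 := hpos _ hz
  have h3 : c * (a + (f a + 1) / c) = c * a + (f a + 1) := by field_simp
  simp only [h3] at this
  linarith

/-- square integrable solutions satisfy f g ≤ 0 far out -/
theorem IsSol7.l2_dec {q f g : ℝ → ℝ} {R : ℝ} (h : IsSol7 q f g) (hq : ∀ z, R ≤ z → 0 ≤ q z)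
    (hi : Integrable (fun z => f z ^ 2)) (z : ℝ) (hz : R ≤ z) : f z * g z ≤ 0 := by
  by_contra hc
  push Not at hc
  have k1 : ∀ y, z ≤ y → 0 ≤ f y * g y := by
    intro y hy
    have := mono_of_deriv7 R (fun z => (h z).1.mul (h z).2) (fun z hz => by
      nlinarith [mul_nonneg (hq z hz) (sq_nonneg (f z)), sq_nonneg (g z)]) hz hy
    simp only [Pi.mul_apply] at this
    linarith
  have hfz : f z ≠ 0 := fun h0 => by simp [h0] at hc
  refine nonint7 hi (c := f z ^ 2) (a := z) (by positivity) fun y hy => ?_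
  have := mono_of_deriv7 z (fun z => (h z).1.mul (h z).1) (fun z hz => by
      nlinarith [k1 z hz]) le_rfl hy
  simp only [Pi.mul_apply] at this
  nlinarith

theorem logder7 {q f g : ℝ → ℝ} {K R : ℝ} (h : IsSol7 q f g) (hq : ∀ z, q z ≤ K) (hK : 0 ≤ K)
    (hf : ∀ z, 0 < f z) (hg : ∀ z, R ≤ z → g z < 0) (z : ℝ) (hz : R ≤ z) :
    g z ^ 2 ≤ K * f z ^ 2 := by
  by_contra hc
  push Not at hc
  set δ := g z ^ 2 - K * f z ^ 2 with hδ
  have hδ0 : 0 < δ := by linarith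
  have k : ∀ y, z ≤ y → δ ≤ g y ^ 2 := by
    intro y hy
    have := mono_of_deriv7 R (E := fun z => g z ^ 2 - K * f z ^ 2)
      (E' := fun z => 2 * g z * (q z * f z) - K * (2 * f z * g z)) (fun z => by
        refine (((h z).2.pow 2).sub (((h z).1.pow 2).const_mul K)).congr_deriv ?_
        simp) (fun y hy => by
          have := mul_nonneg (mul_nonneg (hf y).le (neg_nonneg.2 (hg y hy).le)) (sub_nonneg.2 (hq y))
          nlinarith) hz hy
    have := mul_nonneg hK (sq_nonneg (f y))
    linarith
  refine down7 (fun z => (h z).1) (Real.sqrt_pos.2 hδ0) (a := z) (fun y hy => ?_) (fun y _ => (hf y).le)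
  have h1 := Real.sqrt_le_sqrt (k y hy)
  rw [Real.sqrt_sq_eq_abs, abs_of_neg (hg y (hz.trans hy))] at h1
  linarith

theorem cmp_right7 {V f g p r : ℝ → ℝ} {K R l₀ l : ℝ} (h : IsSol7 (fun z => V z + l₀) f g)
    (hV : ∀ z, V z + l₀ ≤ K) (hK : 0 ≤ K) (hVR : ∀ z, R ≤ z → 0 ≤ V z + l₀)
    (hf : ∀ z, 0 < f z) (hg : ∀ z, R ≤ z → g z < 0) (hl : l₀ ≤ l)
    (hp : IsSol7 (fun z => V z + l) p r) (hi : Integrable (fun z => p z ^ 2)) :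
    (∀ z, HasDerivAt (fun z => p z * r z - g z / f z * p z ^ 2)
      ((r z - g z / f z * p z) ^ 2 + (l - l₀) * p z ^ 2) z) ∧
    ∀ z, p z * r z - g z / f z * p z ^ 2 ≤ 0 := by
  have D : ∀ z, HasDerivAt (fun z => p z * r z - g z / f z * p z ^ 2)
      ((r z - g z / f z * p z) ^ 2 + (l - l₀) * p z ^ 2) z := by
    intro z
    have hfz := (hf z).ne'
    refine (((hp z).1.mul (hp z).2).sub
      ((((h z).2.div (h z).1 hfz)).mul ((hp z).1.pow 2))).congr_deriv ?_
    simp only [Pi.div_apply, Pi.pow_apply]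
    field_simp
    ring
  refine ⟨D, fun z => ?_⟩
  by_contra hc
  push Not at hc
  set δ := p z * r z - g z / f z * p z ^ 2 with hδ
  refine nonint7 hi (c := δ / (K + 1)) (a := max z R) (by positivity) fun y hy => ?_
  have hzy := (le_max_left z R).trans hy
  have hRy := (le_max_right z R).trans hy
  have h1 := mono_of_deriv7 z D (fun y _ => by
    have := mul_nonneg (sub_nonneg.2 hl) (sq_nonneg (p y))
    positivity) le_rfl hzy
  have h2 := hp.l2_dec (R := R) (fun z hz => by linarith [hVR z hz]) hi y hRy
  have h3 := logder7 h hV hK hf hg y hRy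
  have h4 : -(g y / f y) ≤ K + 1 := by
    rw [← neg_div, div_le_iff₀ (hf y)]
    have : g y ^ 2 ≤ ((K + 1) * f y) ^ 2 := by nlinarith [sq_nonneg (f y), mul_nonneg hK (sq_nonneg (f y)), mul_nonneg (mul_nonneg hK hK) (sq_nonneg (f y))]
    have := abs_le_of_sq_le_sq' this (by have := hf y; positivity)
    linarith [this.1]
  rw [div_le_iff₀ (by linarith)]
  simp only [← hδ] at h1
  nlinarith [mul_le_mul_of_nonneg_right h4 (sq_nonneg (p y))]

theorem IsSol7.reflect {q f g : ℝ → ℝ} (h : IsSol7 q f g) (hq : ∀ z, q (-z) = q z) :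
    IsSol7 q (fun z => f (-z)) (fun z => -g (-z)) := fun z =>
  ⟨comp_neg7 (h (-z)).1, (comp_neg7 (h (-z)).2).neg.congr_deriv (by simp [hq])⟩

theorem core7 {V u v : ℝ → ℝ} (hVc : Continuous V) {K R m : ℝ} (hVe : ∀ z, V (-z) = V z)
    (hK : ∀ z, |V z| ≤ K) (hR : 0 ≤ R) (hm : 0 < m) (hVR : ∀ z, R ≤ z → m ≤ V z)
    (hu : IsSol7 V u v) (hu0 : u 0 = 0) (hv0 : 0 < v 0) (hup : ∀ z, 0 < z → 0 < u z)
    (hul : Tendsto u atTop (𝓝 0)) :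
    ∃ l₀ : ℝ, 0 < l₀ ∧ ∃ f g, IsSol7 (fun z => V z + l₀) f g ∧ (∀ z, 0 < f z) ∧
      Integrable (fun z => f z ^ 2) ∧
      ∀ l, l₀ ≤ l → ∀ p r, IsSol7 (fun z => V z + l) p r → Integrable (fun z => p z ^ 2) →
        (∃ c, ∀ z, p z = c * f z) ∧ (l = l₀ ∨ ∀ z, p z = 0) := by
  have hK0 : 0 ≤ K := (abs_nonneg _).trans (hK 0)
  have hb : ∀ l z, |V z + l| ≤ K + |l| := fun l z => (abs_add_le _ _).trans (by linarith [hK z])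
  have hex : ∀ l : ℝ, ∃ f g, IsSol7 (fun z => V z + l) f g ∧ f 0 = 1 ∧ g 0 = 0 := fun l =>
    exists_sol7 (by fun_prop) (hb l)
  choose F G hFG hF0 hG0 using hex
  -- nonnegative on the half line implies positive
  have hpos : ∀ l, (∀ z, 0 ≤ z → 0 ≤ F l z) → ∀ z, 0 ≤ z → 0 < F l z := by
    intro l hl z hz
    refine lt_of_le_of_ne (hl z hz) fun h0 => ?_
    have hz0 : 0 < z := lt_of_le_of_ne hz fun h => by
      rw [← h, hF0] at h0; norm_num at h0
    have hmin : IsLocalMin (F l) z := by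
      filter_upwards [lt_mem_nhds hz0] with y hy
      rw [← h0]; exact hl y hy.le
    have hg := hmin.hasDerivAt_eq_zero (hFG l z).1
    have := ((hFG l).zero (hb l) h0.symm hg 0).1
    rw [hF0] at this
    norm_num at this
  let S : Set ℝ := {l | 0 ≤ l ∧ ∀ z, 0 ≤ z → 0 ≤ F l z}
  have hSne : S.Nonempty := ⟨K, hK0, fun z hz => ((hFG K).grow (a := 0) (fun z _ => by
    linarith [neg_abs_le (V z), hK z]) (by rw [hF0]; norm_num) (hG0 K).ge z hz).le⟩
  have hSb : BddBelow S := ⟨0, fun l hl => hl.1⟩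
  set l₀ := sInf S with hl₀
  have hl₀0 : 0 ≤ l₀ := le_csInf hSne fun l hl => hl.1
  have hl₀S : l₀ ∈ S := by
    refine ⟨hl₀0, fun z hz => ?_⟩
    by_contra hc
    push Not at hc
    obtain ⟨e, he, hnear⟩ := near7 hK (hFG l₀) z (-F l₀ z / 2) (by linarith)
    obtain ⟨l, hlS, hle⟩ := exists_lt_of_csInf_lt hSne (show sInf S < l₀ + e by linarith)
    have hge := csInf_le hSb hlS
    have hsol := hFG l
    rw [show l = l₀ + (l - l₀) by ring] at hsol
    have := (hnear (l - l₀) (by rw [abs_of_nonneg (by linarith)]; linarith) _ _ hsol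
      (by simp [hF0]) (by simp [hG0]) z hz le_rfl).1
    rw [show l₀ + (l - l₀) = l by ring] at this
    have h2 := hlS.2 z hz
    have := (abs_le.1 this).2
    linarith
  -- l₀ is not zero
  have hl₀ne : l₀ ≠ 0 := by
    intro h0
    have hS0 : (0:ℝ) ∈ S := h0 ▸ hl₀S
    have hψ := hFG 0
    have hψp := hpos 0 hS0.2
    have hv : ∀ z, R ≤ z → v z ≤ 0 := by
      intro z hz
      by_contra hc
      push Not at hc
      have hz1 : 0 < z + 1 := by linarith
      have hvm : ∀ y, z ≤ y → 0 ≤ v y := by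
        intro y hy
        have := mono_of_deriv7 z (fun z => (hu z).2) (fun y hy => by
          have h1 := hVR y (hz.trans hy)
          have h2 : 0 ≤ u y := by
            rcases eq_or_lt_of_le (hR.trans (hz.trans hy)) with h | h
            · rw [← h, hu0]
            · exact (hup y h).le
          exact mul_nonneg (by linarith) h2) le_rfl hy
        linarith
      have : ∀ y, z + 1 ≤ y → u (z + 1) ≤ u y := fun y hy =>
        mono_of_deriv7 z (fun z => (hu z).1) hvm (by linarith) hy
      have h3 := ge_of_tendsto hul (eventually_atTop.2 ⟨z + 1, this⟩)
      linarith [hup _ hz1]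
    have hw : ∀ z, v z * F 0 z - u z * G 0 z = v 0 := by
      have hd : ∀ z, HasDerivAt (fun z => v z * F 0 z - u z * G 0 z) 0 z := fun z => by
        refine (((hu z).2.mul (hψ z).1).sub ((hu z).1.mul (hψ z).2)).congr_deriv ?_
        simp only [add_zero]; ring
      intro z
      have := is_const_of_deriv_eq_zero (fun z => (hd z).differentiableAt) (fun z => (hd z).deriv) z 0
      simpa [hF0, hu0] using this
    have hR1 : 0 < R + 1 := by linarith
    have hub : ∀ y, R + 1 ≤ y → u y ≤ u (R + 1) := by
      intro y hy
      have := mono_of_deriv7 R (fun z => (hu z).1.neg) (fun z hz => by linarith [hv z hz])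
        (show R ≤ R + 1 by linarith) hy
      simp only [Pi.neg_apply] at this
      linarith
    have huR := hup _ hR1
    refine down7 (fun z => (hψ z).1) (c := v 0 / u (R + 1)) (a := R + 1) (by positivity)
      (fun z hz => ?_) (fun z hz => (hψp z (by linarith)).le)
    have h1 := hw z
    have h2 := hv z (by linarith)
    have h3 := hψp z (by linarith)
    have h4 := hup z (by linarith)
    have h5 := hub z hz
    have h6 : v 0 ≤ u z * (-G 0 z) := by nlinarith
    have h7 : 0 < -G 0 z := by
      by_contra hc
      push Not at hc
      nlinarith
    have h8 : v 0 / u (R + 1) ≤ -G 0 z := by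
      rw [div_le_iff₀ huR]
      nlinarith
    linarith
  have hl₀p : 0 < l₀ := lt_of_le_of_ne hl₀0 (Ne.symm hl₀ne)
  set f := F l₀ with hf
  set g := G l₀ with hg
  have hs : IsSol7 (fun z => V z + l₀) f g := hFG l₀
  have hfp0 : ∀ z, 0 ≤ z → 0 < f z := hpos l₀ hl₀S.2
  have hfe : ∀ z, f (-z) = f z := by
    intro z
    have hr := hs.reflect (fun z => by simp [hVe])
    have hd : IsSol7 (fun z => V z + l₀) (fun z => f (-z) - f z) (fun z => -g (-z) - g z) := fun z =>
      ⟨(hr z).1.sub (hs z).1, ((hr z).2.sub (hs z).2).congr_deriv (by ring)⟩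
    have := (hd.zero (hb l₀) (a := 0) (by simp) (by simp [hg, hG0]) z).1
    linarith
  have hfp : ∀ z, 0 < f z := by
    intro z
    rcases le_total 0 z with h | h
    · exact hfp0 z h
    · rw [← hfe]; exact hfp0 _ (by linarith)
  have hgneg : ∀ z, R ≤ z → g z < 0 := by
    intro z hz
    by_contra hc
    push Not at hc
    have hz0 := hR.trans hz
    have hqp : ∀ y, z ≤ y → ∀ l, 0 ≤ l → 0 < V y + l := fun y hy l hl => by
      linarith [hVR y (hz.trans hy)]
    -- strictly positive slope at z + 1
    have hslope : 0 < g (z + 1) := by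
      have hsm : StrictMonoOn g (Ici z) := by
        apply strictMonoOn_of_deriv_pos (convex_Ici z)
        · exact fun y _ => (hs y).2.continuousAt.continuousWithinAt
        · intro y hy
          rw [interior_Ici] at hy
          rw [(hs y).2.deriv]
          exact mul_pos (hqp y (le_of_lt hy) l₀ hl₀0) (hfp y)
      exact lt_of_le_of_lt hc (hsm (show z ≤ z from le_rfl) (show z ≤ z + 1 by linarith) (by linarith))
    have hcont : Continuous f := continuous_iff_continuousAt.2 fun z => (hs z).1.continuousAt
    obtain ⟨x, hx, hxm⟩ := (isCompact_Icc (a := (0:ℝ)) (b := z + 1)).exists_isMinOn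
      ⟨0, le_rfl, by linarith⟩ hcont.continuousOn
    have hδ : 0 < min (f x) (g (z + 1)) / 2 := by
      have := lt_min (hfp x) hslope
      linarith
    obtain ⟨e, he, hnear⟩ := near7 hK hs (z + 1) _ hδ
    set t := min (e / 2) l₀ with ht
    have ht0 : 0 < t := lt_min (by linarith) hl₀p
    have hte : t ≤ e / 2 := min_le_left _ _
    have htl : t ≤ l₀ := min_le_right _ _
    have hn := hnear (-t) (by rw [abs_neg, abs_of_pos ht0]; linarith) _ _ (hFG (l₀ + -t))
      (by simp [hf, hF0]) (by simp [hg, hG0])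
    have hm1 : min (f x) (g (z + 1)) ≤ f x := min_le_left _ _
    have hm2 : min (f x) (g (z + 1)) ≤ g (z + 1) := min_le_right _ _
    have hA : ∀ y, 0 ≤ y → y ≤ z + 1 → 0 < F (l₀ + -t) y := by
      intro y hy0 hy1
      have h1 := (abs_le.1 (hn y hy0 hy1).1).1
      have h2 : f x ≤ f y := hxm ⟨hy0, hy1⟩
      have := hfp x
      linarith
    have hB : 0 < G (l₀ + -t) (z + 1) := by
      have h1 := (abs_le.1 (hn (z + 1) (by linarith) le_rfl).2).1
      linarith
    have hin : l₀ + -t ∈ S := by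
      refine ⟨by linarith, fun y hy => ?_⟩
      rcases le_total y (z + 1) with h | h
      · exact (hA y hy h).le
      · exact ((hFG (l₀ + -t)).grow (a := z + 1)
          (fun y hy => (hqp y (by linarith) _ (by linarith)).le)
          (hA _ (by linarith) le_rfl) hB.le y h).le
    have := csInf_le hSb hin
    linarith
  have hfc : Continuous f := continuous_iff_continuousAt.2 fun z => (hs z).1.continuousAt
  have hInteg : Integrable (fun z => f z ^ 2) := by
    -- the derivative (V + l₀) f of g is integrable
    have hgmono : MonotoneOn g (Ici R) := fun x hx y _ hxy =>
      mono_of_deriv7 R (fun z => (hs z).2) (fun z hz =>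
        mul_nonneg (by linarith [hVR z hz]) (hfp z).le) hx hxy
    obtain ⟨ℓ, hℓ⟩ : ∃ ℓ, Tendsto g atTop (𝓝 ℓ) := by
      let g₁ : ℝ → ℝ := fun z => g (max z R)
      have hm1 : Monotone g₁ := fun x y hxy =>
        hgmono (show R ≤ _ from le_max_right _ _) (show R ≤ _ from le_max_right _ _) (max_le_max_right R hxy)
      have hbd : BddAbove (range g₁) := ⟨0, by
        rintro _ ⟨y, rfl⟩; exact (hgneg _ (le_max_right _ _)).le⟩
      refine ⟨_, (tendsto_atTop_ciSup hm1 hbd).congr' ?_⟩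
      filter_upwards [eventually_ge_atTop R] with y hy
      simp [g₁, max_eq_left hy]
    have hI : IntegrableOn (fun z => (V z + l₀) * f z) (Ioi R) :=
      integrableOn_Ioi_deriv_of_nonneg (hs R).2.continuousAt.continuousWithinAt
        (fun z _ => (hs z).2) (fun z hz => mul_nonneg (by
          have : R < z := hz
          linarith [hVR z this.le]) (hfp z).le) hℓ
    have hI2 : IntegrableOn (fun z => f z ^ 2) (Ioi R) := by
      refine Integrable.mono' (hI.const_mul (f R / m)) (by fun_prop) ?_
      refine (ae_restrict_iff' measurableSet_Ioi).2 (Eventually.of_forall fun z hz => ?_)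
      have hz' : R < z := hz
      rw [Real.norm_eq_abs, abs_of_nonneg (sq_nonneg _)]
      have hdec : f z ≤ f R := by
        have := mono_of_deriv7 R (fun z => (hs z).1.neg) (fun z hz => by linarith [hgneg z hz])
          le_rfl hz'.le
        simp only [Pi.neg_apply] at this
        linarith
      have h1 := hVR z hz'.le
      have h2 : m * f z ≤ (V z + l₀) * f z := mul_le_mul_of_nonneg_right (by linarith) (hfp z).le
      calc f z ^ 2 ≤ f R * f z := by nlinarith [hfp z]
        _ = f R / m * (m * f z) := by field_simp
        _ ≤ _ := mul_le_mul_of_nonneg_left h2 (div_nonneg (hfp R).le hm.le)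
    have hI3 : IntegrableOn (fun z => f z ^ 2) (Iio (-R)) := by
      have := (Measure.measurePreserving_neg (volume : Measure ℝ)).integrableOn_comp_preimage
        (MeasurableEquiv.neg ℝ).measurableEmbedding (f := fun z => f z ^ 2) (s := Ioi R)
      have h2 := this.2 hI2
      simpa [Function.comp_def, hfe] using h2
    have hI4 : IntegrableOn (fun z => f z ^ 2) (Icc (-R) R) :=
      (by fun_prop : Continuous fun z => f z ^ 2).continuousOn.integrableOn_Icc
    have := (hI3.union hI4).union hI2
    rw [← integrableOn_univ]
    refine this.mono_set fun x _ => ?_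
    rcases lt_or_ge x (-R) with h | h
    · exact Or.inl (Or.inl h)
    · rcases le_or_gt x R with h' | h'
      · exact Or.inl (Or.inr ⟨h, h'⟩)
      · exact Or.inr h'
  refine ⟨l₀, hl₀p, f, g, hs, hfp, hInteg, ?_⟩
  intro l hl p r hp hi
  have hVb : ∀ z, V z + l₀ ≤ K + |l₀| := fun z => (le_abs_self _).trans (hb l₀ z)
  have hVR0 : ∀ z, R ≤ z → 0 ≤ V z + l₀ := fun z hz => by linarith [hVR z hz]
  obtain ⟨D, h1⟩ := cmp_right7 hs hVb (by positivity) hVR0 hfp hgneg hl hp hi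
  have hge : ∀ z, g (-z) = -g z := by
    intro z
    have e : (fun z => f (-z)) = f := funext hfe
    have := comp_neg7 (hs (-z)).1
    rw [e] at this
    have := this.unique (hs z).1
    linarith
  have h2 := (cmp_right7 hs hVb (by positivity) hVR0 hfp hgneg hl
    (hp.reflect (fun z => by simp [hVe])) (by simpa using hi.comp_neg)).2
  have h3 : ∀ z, p z * r z - g z / f z * p z ^ 2 = 0 := by
    intro z
    refine le_antisymm (h1 z) ?_
    have := h2 (-z)
    simp only [neg_neg, hge, hfe, neg_div] at this
    linarith
  have h4 : ∀ z, (r z - g z / f z * p z) ^ 2 + (l - l₀) * p z ^ 2 = 0 := by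
    intro z
    have e : (fun z => p z * r z - g z / f z * p z ^ 2) = fun _ => 0 := funext h3
    have hD := D z
    rw [e] at hD
    exact hD.unique (hasDerivAt_const z 0)
  have hnn : ∀ z, 0 ≤ (l - l₀) * p z ^ 2 := fun z => mul_nonneg (by linarith) (sq_nonneg _)
  constructor
  · have h5 : ∀ z, r z = g z / f z * p z := fun z => by
      have : (r z - g z / f z * p z) ^ 2 = 0 := by nlinarith [h4 z, hnn z, sq_nonneg (r z - g z / f z * p z)]
      have := pow_eq_zero_iff (two_ne_zero) |>.1 this
      linarith
    have hd : ∀ z, HasDerivAt (fun z => p z / f z) 0 z := fun z => by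
      refine ((hp z).1.div (hs z).1 (hfp z).ne').congr_deriv ?_
      rw [h5]
      have := (hfp z).ne'
      field_simp
      ring
    refine ⟨p 0 / f 0, fun z => ?_⟩
    have := is_const_of_deriv_eq_zero (fun z => (hd z).differentiableAt) (fun z => (hd z).deriv) z 0
    rw [← this, div_mul_cancel₀ _ (hfp z).ne']
  · by_cases he : l = l₀
    · exact Or.inl he
    · right
      intro z
      have hlt : 0 < l - l₀ := sub_pos.2 (lt_of_le_of_ne hl (Ne.symm he))
      have := hnn z
      have h5 : (l - l₀) * p z ^ 2 = 0 := by nlinarith [h4 z, sq_nonneg (r z - g z / f z * p z)]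
      rcases mul_eq_zero.1 h5 with h | h
      · exact absurd h hlt.ne'
      · exact pow_eq_zero_iff two_ne_zero |>.1 h

theorem refl7 {W' ddW φ : ℝ → ℝ} {M K : ℝ} (hW : ∀ x, HasDerivAt W' (ddW x) x)
    (hK : ∀ x ∈ Icc (-M) M, |ddW x| ≤ K) (hM : ∀ z, φ z ∈ Icc (-M) M) {φ' : ℝ → ℝ}
    (h1 : ∀ z, HasDerivAt φ (φ' z) z) (h2 : ∀ z, HasDerivAt φ' (W' (φ z)) z) {a : ℝ}
    (ha : φ' a = 0) (z : ℝ) : φ (2 * a - z) = φ z := by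
  have hlin : ∀ z : ℝ, HasDerivAt (fun z => 2 * a - z) (-1) z := fun z =>
    (hasDerivAt_id z).const_sub _
  have := zero7 (f := fun z => φ z - φ (2 * a - z)) (g := fun z => φ' z + φ' (2 * a - z))
    (h := fun z => W' (φ z) - W' (φ (2 * a - z))) (K := K) (a := a)
    (fun z => ((h1 z).sub ((h1 (2 * a - z)).comp z (hlin z))).congr_deriv (by ring))
    (fun z => ((h2 z).add ((h2 (2 * a - z)).comp z (hlin z))).congr_deriv (by ring))
    (fun z => by
      have := (convex_Icc (-M) M).norm_image_sub_le_of_norm_hasDerivWithin_le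
        (fun x _ => (hW x).hasDerivWithinAt) (C := K)
        (fun x hx => by rw [Real.norm_eq_abs]; exact hK x hx) (hM (2 * a - z)) (hM z)
      simpa [Real.norm_eq_abs] using this)
    (by simp [two_mul]) (by simp [two_mul, ha]) z
  linarith [this.1]

theorem periodic7 {φ : ℝ → ℝ} {b c : ℝ} (hT : Tendsto φ atTop (𝓝 b)) (hc : 0 < c)
    (hp : ∀ z, φ (z + c) = φ z) (z : ℝ) : φ z = b := by
  have h1 : ∀ n : ℕ, φ (z + n * c) = φ z := by
    intro n
    induction n with
    | zero => simp
    | succ k ih =>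
      rw [← ih, ← hp (z + k * c)]
      congr 1
      push_cast; ring
  have h2 : Tendsto (fun n : ℕ => z + n * c) atTop atTop :=
    tendsto_atTop_add_const_left _ _ (tendsto_natCast_atTop_atTop.atTop_mul_const hc)
  have h3 := hT.comp h2
  have h4 : φ ∘ (fun n : ℕ => z + n * c) = fun _ => φ z := funext h1
  rw [h4] at h3
  exact tendsto_nhds_unique tendsto_const_nhds h3

theorem isSol_of7 {q ψ : ℝ → ℝ} {l : ℝ} (h : ContDiff ℝ 2 ψ)
    (he : ∀ z, iteratedDeriv 2 ψ z - q z * ψ z = l * ψ z) :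
    IsSol7 (fun z => q z + l) ψ (deriv ψ) := by
  have h1 : ContDiff ℝ 1 (deriv ψ) := by
    have h' : ContDiff ℝ (1 + 1) ψ := by simpa [one_add_one_eq_two] using h
    exact (contDiff_succ_iff_deriv.1 h').2.2
  intro z
  refine ⟨(h.differentiable (by norm_num) z).hasDerivAt, ?_⟩
  refine (h1.differentiable (by norm_num) z).hasDerivAt.congr_deriv ?_
  have := he z
  rw [iteratedDeriv_succ, iteratedDeriv_one] at this
  linarith

theorem isSol_to7 {q f g : ℝ → ℝ} (hq : Continuous q) (h : IsSol7 q f g) :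
    ContDiff ℝ 2 f ∧ ∀ z, iteratedDeriv 2 f z = q z * f z := by
  have e1 : deriv f = g := funext fun z => (h z).1.deriv
  have e2 : deriv g = fun z => q z * f z := funext fun z => (h z).2.deriv
  have hfc : Continuous f := continuous_iff_continuousAt.2 fun z => (h z).1.continuousAt
  constructor
  · have hg : ContDiff ℝ 1 g := by
      rw [contDiff_one_iff_deriv, e2]
      exact ⟨fun z => (h z).2.differentiableAt, by fun_prop⟩
    have : ContDiff ℝ (1 + 1) f := by
      rw [contDiff_succ_iff_deriv, e1]
      exact ⟨fun z => (h z).1.differentiableAt, by simp, hg⟩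
    simpa [one_add_one_eq_two] using this
  · intro z
    rw [iteratedDeriv_succ, iteratedDeriv_one, e1, e2]

theorem IsSol7.shift {q f g : ℝ → ℝ} (h : IsSol7 q f g) (a : ℝ) :
    IsSol7 (fun z => q (z + a)) (fun z => f (z + a)) (fun z => g (z + a)) := fun z =>
  ⟨(h (z + a)).1.comp_add_const z a, (h (z + a)).2.comp_add_const z a⟩

/-- for a nonconstant homoclinic φ of φ″ = W′(φ), the linearization
L₀ = d²/dz² − W″(φ) has 0 as eigenvalue with eigenfunction φ′, φ′ vanishes at
exactly one point, and L₀ has a positive simple ground-state eigenvalue λ₀ > 0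
with positive eigenfunction ψ₀. -/
theorem stmt_7 (W : ℝ → ℝ) (hW : ContDiff ℝ (⊤ : ℕ∞) W) (bm : ℝ)
    (ham : 0 < iteratedDeriv 2 W bm)
    (φ : ℝ → ℝ) (hφ : ContDiff ℝ (⊤ : ℕ∞) φ)
    (hode : ∀ z, iteratedDeriv 2 φ z = deriv W (φ z))
    (hhomT : Filter.Tendsto φ Filter.atTop (nhds bm))
    (hhomB : Filter.Tendsto φ Filter.atBot (nhds bm))
    (hdT : Filter.Tendsto (deriv φ) Filter.atTop (nhds 0))
    (hdB : Filter.Tendsto (deriv φ) Filter.atBot (nhds 0))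
    (hnc : φ ≠ fun _ => bm) :
    (∀ z, iteratedDeriv 2 (deriv φ) z - iteratedDeriv 2 W (φ z) * deriv φ z = 0) ∧
    (∃! z₀, deriv φ z₀ = 0) ∧
    (∃ lam₀ : ℝ, 0 < lam₀ ∧ ∃ ψ₀ : ℝ → ℝ, ContDiff ℝ 2 ψ₀ ∧ (∀ z, 0 < ψ₀ z) ∧
      MeasureTheory.Integrable (fun z => ψ₀ z ^ 2) ∧
      (∀ z, iteratedDeriv 2 ψ₀ z - iteratedDeriv 2 W (φ z) * ψ₀ z = lam₀ * ψ₀ z) ∧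
      (∀ lam : ℝ, ∀ ψ : ℝ → ℝ, ContDiff ℝ 2 ψ → (∃ z, ψ z ≠ 0) →
        MeasureTheory.Integrable (fun z => ψ z ^ 2) →
        (∀ z, iteratedDeriv 2 ψ z - iteratedDeriv 2 W (φ z) * ψ z = lam * ψ z) →
        lam ≤ lam₀) ∧
      (∀ ψ : ℝ → ℝ, ContDiff ℝ 2 ψ →
        MeasureTheory.Integrable (fun z => ψ z ^ 2) →
        (∀ z, iteratedDeriv 2 ψ z - iteratedDeriv 2 W (φ z) * ψ z = lam₀ * ψ z) →
        ∃ cc : ℝ, ψ = fun z => cc * ψ₀ z)) := by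
  have hφ1 : ∀ z, HasDerivAt φ (deriv φ z) z := fun z =>
    (hφ.differentiable (by simp) z).hasDerivAt
  have hdφ : ContDiff ℝ (⊤ : ℕ∞) (deriv φ) := (contDiff_infty_iff_deriv.1 hφ).2
  have hφ2 : ∀ z, HasDerivAt (deriv φ) (deriv W (φ z)) z := fun z => by
    rw [← hode z, iteratedDeriv_succ, iteratedDeriv_one]
    exact (hdφ.differentiable (by simp) z).hasDerivAt
  have hdW : ContDiff ℝ (⊤ : ℕ∞) (deriv W) := (contDiff_infty_iff_deriv.1 hW).2
  have hW2 : ∀ x, HasDerivAt (deriv W) (iteratedDeriv 2 W x) x := fun x => by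
    rw [iteratedDeriv_succ, iteratedDeriv_one]
    exact (hdW.differentiable (by simp) x).hasDerivAt
  have hW2c : Continuous (iteratedDeriv 2 W) := by
    have e : iteratedDeriv 2 W = deriv (deriv W) := by rw [iteratedDeriv_succ, iteratedDeriv_one]
    rw [e]
    exact (contDiff_infty_iff_deriv.1 hdW).2.continuous
  have hφc : Continuous φ := hφ.continuous
  have hV0c : Continuous (fun z => iteratedDeriv 2 W (φ z)) := hW2c.comp hφc
  have hsol : IsSol7 (fun z => iteratedDeriv 2 W (φ z)) (deriv φ) (fun z => deriv W (φ z)) :=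
    fun z => ⟨hφ2 z, (hW2 (φ z)).comp z (hφ1 z)⟩
  have hco : Tendsto φ (cocompact ℝ) (𝓝 bm) := by
    rw [cocompact_eq_atBot_atTop]
    exact hhomB.sup hhomT
  -- boundedness
  obtain ⟨M, hM⟩ : ∃ M, ∀ z, φ z ∈ Icc (-M) M := by
    have : Bornology.IsBounded (range φ) := by
      have h1 : ∀ᶠ z in cocompact ℝ, φ z ∈ Metric.closedBall bm 1 :=
        hco (Metric.closedBall_mem_nhds bm one_pos)
      obtain ⟨t, ht, hts⟩ := mem_cocompact.1 h1
      refine ((ht.image hφc).isBounded.union (Metric.isBounded_closedBall (x := bm) (r := 1))).subset ?_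
      rintro _ ⟨z, rfl⟩
      by_cases hz : z ∈ t
      · exact Or.inl ⟨z, hz, rfl⟩
      · exact Or.inr (hts hz)
    obtain ⟨M, hM⟩ := this.exists_norm_le
    exact ⟨M, fun z => abs_le.1 (hM _ ⟨z, rfl⟩)⟩
  obtain ⟨K, hK⟩ := (isCompact_Icc (a := -M) (b := M)).exists_bound_of_continuousOn hW2c.continuousOn
  simp only [Real.norm_eq_abs] at hK
  have hrefl : ∀ a, deriv φ a = 0 → ∀ z, φ (2 * a - z) = φ z := fun a ha z =>
    refl7 hW2 hK hM hφ1 hφ2 ha z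
  obtain ⟨x₀, hx₀⟩ : ∃ x, φ x ≠ bm := by
    by_contra hc
    push Not at hc
    exact hnc (funext hc)
  -- existence of a critical point
  obtain ⟨a, ha⟩ : ∃ a, deriv φ a = 0 := by
    have hc : Continuous (fun z => (φ z - bm) ^ 2) := by fun_prop
    have hp : 0 < (φ x₀ - bm) ^ 2 := by
      have := sub_ne_zero.2 hx₀
      positivity
    have hl : Tendsto (fun z => (φ z - bm) ^ 2) (cocompact ℝ) (𝓝 0) := by
      simpa using (hco.sub_const bm).pow 2
    obtain ⟨a, ha⟩ := hc.exists_forall_ge' x₀ ((hl.eventually (gt_mem_nhds hp)).mono fun _ h => h.le)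
    refine ⟨a, ?_⟩
    have hm : IsLocalMax (fun z => (φ z - bm) ^ 2) a := Eventually.of_forall ha
    have hd : HasDerivAt (fun z => (φ z - bm) ^ 2) (2 * (φ a - bm) * deriv φ a) a :=
      (((hφ1 a).sub_const bm).pow 2).congr_deriv (by simp)
    have := hm.hasDerivAt_eq_zero hd
    have hne : φ a - bm ≠ 0 := fun h0 => by
      have := ha x₀
      simp only [h0] at this
      nlinarith
    simpa [hne] using this
  have huniq : ∀ b, deriv φ b = 0 → b = a := by
    intro b hb
    by_contra hne
    have hper : ∀ a b, deriv φ a = 0 → deriv φ b = 0 → ∀ z, φ (z + 2 * (a - b)) = φ z := by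
      intro a b ha hb z
      rw [← hrefl b hb z, ← hrefl a ha (2 * b - z)]
      congr 1
      ring
    rcases lt_or_gt_of_ne hne with h | h
    · exact hx₀ (periodic7 hhomT (c := 2 * (a - b)) (by linarith) (hper a b ha hb) x₀)
    · exact hx₀ (periodic7 hhomT (c := 2 * (b - a)) (by linarith) (hper b a hb ha) x₀)
  refine ⟨fun z => ?_, ⟨a, ha, huniq⟩, ?_⟩
  · have := (isSol_to7 hV0c hsol).2 z
    rw [this]; ring
  -- the translated problem
  have hKV : ∀ z, |iteratedDeriv 2 W (φ z)| ≤ K := fun z => hK _ (hM z)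
  have hv0 : deriv W (φ a) ≠ 0 := by
    intro h0
    have := (hsol.zero hKV ha h0 (a + 1)).1
    have := huniq _ this
    linarith
  obtain ⟨σ, hσ⟩ : ∃ σ : ℝ, 0 < σ * deriv W (φ a) := ⟨deriv W (φ a), mul_self_pos.2 hv0⟩
  have hσ0 : σ ≠ 0 := fun h => by simp [h] at hσ
  have hsh := hsol.shift a
  have hu : IsSol7 (fun z => iteratedDeriv 2 W (φ (z + a))) (fun z => σ * deriv φ (z + a))
      (fun z => σ * deriv W (φ (z + a))) := fun z =>
    ⟨(hsh z).1.const_mul σ, ((hsh z).2.const_mul σ).congr_deriv (by ring)⟩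
  have hune : ∀ z, 0 < z → σ * deriv φ (z + a) ≠ 0 := by
    intro z hz h0
    rcases mul_eq_zero.1 h0 with h | h
    · exact hσ0 h
    · have := huniq _ h
      linarith
  have huc : Continuous (fun z => σ * deriv φ (z + a)) :=
    continuous_iff_continuousAt.2 fun z => (hu z).1.continuousAt
  have hup : ∀ z, 0 < z → 0 < σ * deriv φ (z + a) := by
    intro z hz
    by_contra hc
    push Not at hc
    have hd := (hu 0).1
    have hev := eventually_nhdsWithin_sign_eq_of_deriv_pos (f := fun z => σ * deriv φ (z + a)) (x₀ := 0)
      (by rw [hd.deriv]; simpa using hσ) (by simp [ha])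
    have hev2 : ∀ᶠ x in 𝓝[>] (0:ℝ), SignType.sign (σ * deriv φ (x + a)) = SignType.sign (x - 0) :=
      hev.filter_mono nhdsWithin_le_nhds
    obtain ⟨y, hy, hy2⟩ := (hev2.and (Ioo_mem_nhdsGT hz)).exists
    rw [sub_zero, sign_pos hy2.1, sign_eq_one_iff] at hy
    obtain ⟨x, hx, hx0⟩ := intermediate_value_Icc' hy2.2.le huc.continuousOn ⟨hc, hy.le⟩
    exact hune x (hy2.1.trans_le hx.1) hx0
  have hadd : Tendsto (fun z : ℝ => z + a) atTop atTop := tendsto_atTop_add_const_right _ _ tendsto_id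
  have hVl : Tendsto (fun z => iteratedDeriv 2 W (φ (z + a))) atTop (𝓝 (iteratedDeriv 2 W bm)) :=
    (hW2c.tendsto bm).comp (hhomT.comp hadd)
  obtain ⟨R, hR⟩ := eventually_atTop.1
    (hVl.eventually (lt_mem_nhds (show iteratedDeriv 2 W bm / 2 < iteratedDeriv 2 W bm by linarith)))
  obtain ⟨l₀, hl₀, f, g, hs, hfp, hInteg, hmax⟩ := core7 (V := fun z => iteratedDeriv 2 W (φ (z + a)))
    (K := K) (R := max R 0) (m := iteratedDeriv 2 W bm / 2) (hV0c.comp (by fun_prop : Continuous fun z => z + a))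
    (fun z => by
      have := hrefl a ha (z + a)
      rw [show 2 * a - (z + a) = -z + a by ring] at this
      simp only [this]) (fun z => hKV _) (le_max_right _ _) (by linarith)
    (fun z hz => (hR z ((le_max_left _ _).trans hz)).le) hu (by simp [ha]) (by simpa using hσ) hup
    (by simpa using (hdT.comp hadd).const_mul σ)
  have hs' : IsSol7 (fun z => iteratedDeriv 2 W (φ z) + l₀) (fun z => f (z + -a)) (fun z => g (z + -a)) := by
    have := hs.shift (-a)
    simpa using this
  obtain ⟨c1, c2⟩ := isSol_to7 (by fun_prop) hs'
  have hback : ∀ l : ℝ, l₀ ≤ l → ∀ ψ : ℝ → ℝ, ContDiff ℝ 2 ψ → Integrable (fun z => ψ z ^ 2) →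
      (∀ z, iteratedDeriv 2 ψ z - iteratedDeriv 2 W (φ z) * ψ z = l * ψ z) →
      (∃ c, ψ = fun z => c * f (z + -a)) ∧ (l = l₀ ∨ ∀ z, ψ z = 0) := by
    intro l hl ψ hψ hi he
    have hq := (isSol_of7 (q := fun z => iteratedDeriv 2 W (φ z)) hψ he).shift a
    obtain ⟨⟨c, hc⟩, h2⟩ := hmax l hl _ _ hq (hi.comp_add_right a)
    refine ⟨⟨c, funext fun z => ?_⟩, h2.imp_right fun h z => ?_⟩
    · have := hc (z + -a)
      simpa using this
    · have := h (z + -a)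
      simpa using this
  refine ⟨l₀, hl₀, fun z => f (z + -a), c1, fun z => hfp _, hInteg.comp_add_right (-a), ?_, ?_, ?_⟩
  · intro z
    rw [c2]; ring
  · intro l ψ hψ hne hi he
    by_contra hc
    push Not at hc
    rcases (hback l hc.le ψ hψ hi he).2 with h | h
    · exact hc.ne' h
    · obtain ⟨z, hz⟩ := hne
      exact hz (h z)
  · intro ψ hψ hi he
    exact (hback l₀ le_rfl ψ hψ hi he).1
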